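/- arXiv:2412.06911 — 7 statements merged into one kernel-verified Lean document; each statement's English description precedes it below -/
import Mathlib

section
/- Let n ≥ 2, let A ∈ ℝ^{n×n} be invertible, and let B, C, M ∈ ℝⁿ with CᵀAB > 0, CᵀA⁻¹M ≠ 0 and CᵀA⁻¹B ≠ 0. For μ ∈ ℝ define the regular equilibrium x_reg(μ) = −A⁻¹Mμ (the unique solution of Ax + Mμ = 0), and let x_ps(μ) be the unique x ∈ ℝⁿ satisfying (I − B CᵀA/(CᵀAB))(Ax + Mμ) = 0 and Cᵀx = 0 (the pseudo-equilibrium), with a_ps(μ) = CᵀA(Ax_ps(μ) + Mμ). Then Cᵀx_reg(μ) = −(CᵀA⁻¹M)μ and a_ps(μ) = (CᵀAB · CᵀA⁻¹M / CᵀA⁻¹B)μ, and: (i) if CᵀA⁻¹B < 0 then for every μ ≠ 0 exactly one of the admissibility conditions Cᵀx_reg(μ) > 0 and a_ps(μ) < 0 holds, so the regular and pseudo-equilibria are admissible on opposite sides of μ = 0 (persistence); (ii) if CᵀA⁻¹B > 0 then for every μ ≠ 0 the two conditions Cᵀx_reg(μ) > 0 and a_ps(μ) < 0 either both hold or both fail,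 and both hold for exactly one sign of μ (nonsmooth fold). -/
open Matrix

/-- The acceleration at a pseudo-equilibrium, multiplied by `CᵀA⁻¹B`. -/
theorem pseudoEquilibrium_acceleration {ι : Type*} [Fintype ι] [DecidableEq ι]
    {A : Matrix ι ι ℝ} (hA : IsUnit A.det) {B C N x : ι → ℝ}
    (hCAB : C ⬝ᵥ A.mulVec B ≠ 0)
    (hx : ((1 : Matrix ι ι ℝ) -
        (C ⬝ᵥ A.mulVec B)⁻¹ • vecMulVec B (vecMul C A)).mulVec (A.mulVec x + N) = 0)
    (hCx : C ⬝ᵥ x = 0) :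
    (C ⬝ᵥ A.mulVec (A.mulVec x + N)) * (C ⬝ᵥ A⁻¹.mulVec B) =
      (C ⬝ᵥ A.mulVec B) * (C ⬝ᵥ A⁻¹.mulVec N) := by
  have key : A.mulVec x + N =
      ((C ⬝ᵥ A.mulVec B)⁻¹ * (C ⬝ᵥ A.mulVec (A.mulVec x + N))) • B := by
    rw [sub_mulVec, one_mulVec, sub_eq_zero, smul_mulVec, vecMulVec_mulVec,
      ← dotProduct_mulVec, op_smul_eq_smul, smul_smul] at hx
    exact hx
  have h := congrArg (fun y => C ⬝ᵥ A⁻¹.mulVec y) key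
  simp only [mulVec_add A⁻¹, mulVec_mulVec x A⁻¹ A, nonsing_inv_mul A hA, one_mulVec,
    dotProduct_add, hCx, zero_add, mulVec_smul, dotProduct_smul, smul_eq_mul] at h
  rw [h, ← mul_assoc, ← mul_assoc, mul_inv_cancel₀ hCAB, one_mul]

/-- **Classification of boundary equilibrium bifurcations (Theorem 2.1, di Bernardo et al.).**
For the leading-order impacting hybrid system `ẋ = Ax + Mμ` for `Cᵀx > 0` with reset
vector `B`, suppose `A` is invertible, `CᵀAB > 0`, `CᵀA⁻¹M ≠ 0`, `CᵀA⁻¹B ≠ 0`. With the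
regular equilibrium `x_reg(μ) = -A⁻¹Mμ` and the pseudo-equilibrium `x_ps(μ)` (the zero of
the sticking field on `Cᵀx = 0`) with acceleration `a_ps(μ) = CᵀA(Ax_ps(μ) + Mμ)`, one has
`Cᵀx_reg(μ) = -(CᵀA⁻¹M)μ` and `a_ps(μ) = (CᵀAB·CᵀA⁻¹M/CᵀA⁻¹B)μ`; if `CᵀA⁻¹B < 0` the two
admissibility conditions hold on opposite sides of `μ = 0` (persistence), while if
`CᵀA⁻¹B > 0` they hold together, on exactly one sign of `μ` (nonsmooth fold). -/
theorem beb_classification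
    (n : ℕ) (hn : 2 ≤ n)
    (A : Matrix (Fin n) (Fin n) ℝ) (hA : IsUnit A.det)
    (B C M : Fin n → ℝ)
    (hCAB : 0 < C ⬝ᵥ A.mulVec B)
    (hCAM : C ⬝ᵥ A⁻¹.mulVec M ≠ 0)
    (hCAiB : C ⬝ᵥ A⁻¹.mulVec B ≠ 0)
    (xreg : ℝ → (Fin n → ℝ)) (hxreg : ∀ μ, xreg μ = -(μ • A⁻¹.mulVec M))
    (xps : ℝ → (Fin n → ℝ))
    (hxps : ∀ μ,
      ((1 : Matrix (Fin n) (Fin n) ℝ) -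
          (C ⬝ᵥ A.mulVec B)⁻¹ • vecMulVec B (Matrix.vecMul C A)).mulVec
        (A.mulVec (xps μ) + μ • M) = 0 ∧
      C ⬝ᵥ xps μ = 0)
    (aps : ℝ → ℝ)
    (haps : ∀ μ, aps μ = C ⬝ᵥ A.mulVec (A.mulVec (xps μ) + μ • M)) :
    (∀ μ, C ⬝ᵥ xreg μ = -(C ⬝ᵥ A⁻¹.mulVec M) * μ) ∧
    (∀ μ, aps μ =
      (C ⬝ᵥ A.mulVec B) * (C ⬝ᵥ A⁻¹.mulVec M) / (C ⬝ᵥ A⁻¹.mulVec B) * μ) ∧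
    -- (i) persistence
    (C ⬝ᵥ A⁻¹.mulVec B < 0 →
      ∀ μ : ℝ, μ ≠ 0 → Xor' (0 < C ⬝ᵥ xreg μ) (aps μ < 0)) ∧
    -- (ii) nonsmooth fold
    (0 < C ⬝ᵥ A⁻¹.mulVec B →
      (∀ μ : ℝ, μ ≠ 0 → (0 < C ⬝ᵥ xreg μ ↔ aps μ < 0)) ∧
      Xor' (∀ μ : ℝ, 0 < μ → 0 < C ⬝ᵥ xreg μ ∧ aps μ < 0)
           (∀ μ : ℝ, μ < 0 → 0 < C ⬝ᵥ xreg μ ∧ aps μ < 0)) := by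
  have hreg : ∀ μ, C ⬝ᵥ xreg μ = -(C ⬝ᵥ A⁻¹.mulVec M) * μ := fun μ => by
    rw [hxreg, dotProduct_neg, dotProduct_smul, smul_eq_mul]
    ring
  have hacc : ∀ μ, aps μ =
      (C ⬝ᵥ A.mulVec B) * (C ⬝ᵥ A⁻¹.mulVec M) / (C ⬝ᵥ A⁻¹.mulVec B) * μ := fun μ => by
    have h := pseudoEquilibrium_acceleration hA hCAB.ne' (hxps μ).1 (hxps μ).2
    rw [← haps, mulVec_smul, dotProduct_smul, smul_eq_mul] at h
    rw [div_mul_eq_mul_div, eq_div_iff hCAiB, h]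
    ring
  refine ⟨hreg, hacc, ?_⟩
  have hratio : ∀ μ, aps μ =
      -((C ⬝ᵥ A.mulVec B) / (C ⬝ᵥ A⁻¹.mulVec B)) * (C ⬝ᵥ xreg μ) := fun μ => by
    rw [hacc, hreg]
    ring
  have hne : ∀ μ, μ ≠ 0 → C ⬝ᵥ xreg μ ≠ 0 := fun μ hμ => by
    rw [hreg]
    exact mul_ne_zero (neg_ne_zero.2 hCAM) hμ
  constructor
  · intro hneg μ hμ
    have hpos := neg_pos.2 (div_neg_of_pos_of_neg hCAB hneg)
    have hiff : aps μ < 0 ↔ C ⬝ᵥ xreg μ < 0 := by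
      simp only [hratio, mul_neg_iff, hpos, hpos.not_gt, true_and, false_and, or_false]
    rw [hiff]
    rcases lt_or_gt_of_ne (hne μ hμ) with h | h
    · exact Or.inr ⟨h, h.not_gt⟩
    · exact Or.inl ⟨h, h.not_gt⟩
  · intro hpos
    have hiff : ∀ μ, 0 < C ⬝ᵥ xreg μ ↔ aps μ < 0 := fun μ => by
      rw [hratio, neg_mul, neg_lt_zero, mul_pos_iff_of_pos_left (div_pos hCAB hpos)]
    refine ⟨fun μ _ => hiff μ, ?_⟩
    simp only [← hiff, and_self, hreg]
    rcases lt_or_gt_of_ne hCAM with h | h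
    · refine Or.inl ⟨fun μ hμ => mul_pos (neg_pos.2 h) hμ, fun H => ?_⟩
      linarith [H (-1) (by norm_num)]
    · refine Or.inr ⟨fun μ hμ => mul_pos_of_neg_of_neg (neg_lt_zero.2 h) hμ, fun H => ?_⟩
      linarith [H 1 one_pos]
end

section
/- Let n ≥ 2, let A ∈ ℝ^{n×n} be invertible, let B, C, M ∈ ℝⁿ with B ≠ 0, CᵀAB ≠ 0 and CᵀA⁻¹B ≠ 0, and let μ ∈ ℝ. Then there is exactly one x ∈ ℝⁿ satisfying both (I − B CᵀA/(CᵀAB))(Ax + Mμ) = 0 and Cᵀx = 0, namely x = A⁻¹(Bs − Mμ) with s = (CᵀA⁻¹M / CᵀA⁻¹B)μ; moreover this x satisfies CᵀA(Ax + Mμ) = (CᵀAB · CᵀA⁻¹M / CᵀA⁻¹B)μ. -/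
open Matrix

/-- The oblique projection `I − B CᵀA/(CᵀAB)` subtracts a multiple of `B`. -/
theorem one_sub_smul_vecMulVec_mulVec {m : Type*} [Fintype m] [DecidableEq m]
    (A : Matrix m m ℝ) (B C y : m → ℝ) (c : ℝ) :
    ((1 : Matrix m m ℝ) - c • vecMulVec B (C ᵥ* A)) *ᵥ y = y - (c * (C ⬝ᵥ A *ᵥ y)) • B := by
  rw [sub_mulVec, one_mulVec, smul_mulVec, vecMulVec_mulVec, op_smul_eq_smul, smul_smul,
    ← dotProduct_mulVec]

/-- **Existence and uniqueness of the pseudo-equilibrium (Section 2.1).**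
For the leading-order impacting hybrid system `ẋ = Ax + Mμ` for `Cᵀx > 0` with reset
vector `B`, there is exactly one zero of the sticking vector field
`F_s(x) = (I − B CᵀA/(CᵀAB))(Ax + Mμ)` on the switching surface `Cᵀx = 0`, namely
`x = A⁻¹(Bs − Mμ)` with `s = (CᵀA⁻¹M/CᵀA⁻¹B)μ`, and its acceleration is
`CᵀA(Ax + Mμ) = (CᵀAB·CᵀA⁻¹M/CᵀA⁻¹B)μ`. -/
theorem pseudo_equilibrium_unique
    (n : ℕ) (hn : 2 ≤ n)
    (A : Matrix (Fin n) (Fin n) ℝ) (hA : IsUnit A.det)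
    (B C M : Fin n → ℝ) (hB : B ≠ 0)
    (hCAB : C ⬝ᵥ A.mulVec B ≠ 0)
    (hCAiB : C ⬝ᵥ A⁻¹.mulVec B ≠ 0)
    (μ : ℝ)
    (s : ℝ) (hs : s = (C ⬝ᵥ A⁻¹.mulVec M) / (C ⬝ᵥ A⁻¹.mulVec B) * μ)
    (x₀ : Fin n → ℝ) (hx₀ : x₀ = A⁻¹.mulVec (s • B - μ • M)) :
    (∀ x : Fin n → ℝ,
      (((1 : Matrix (Fin n) (Fin n) ℝ) -
          (C ⬝ᵥ A.mulVec B)⁻¹ • vecMulVec B (Matrix.vecMul C A)).mulVec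
        (A.mulVec x + μ • M) = 0 ∧ C ⬝ᵥ x = 0) ↔ x = x₀) ∧
    C ⬝ᵥ A.mulVec (A.mulVec x₀ + μ • M) =
      (C ⬝ᵥ A.mulVec B) * (C ⬝ᵥ A⁻¹.mulVec M) / (C ⬝ᵥ A⁻¹.mulVec B) * μ := by
  have hAx₀ : A *ᵥ x₀ + μ • M = s • B := by
    rw [hx₀, mulVec_mulVec, mul_nonsing_inv A hA, one_mulVec, sub_add_cancel]
  have hCx (t : ℝ) : C ⬝ᵥ A⁻¹ *ᵥ (t • B - μ • M) =
      t * (C ⬝ᵥ A⁻¹ *ᵥ B) - μ * (C ⬝ᵥ A⁻¹ *ᵥ M) := by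
    simp only [mulVec_sub, mulVec_smul, dotProduct_sub, dotProduct_smul, smul_eq_mul]
  refine ⟨fun x => ?_, ?_⟩
  · rw [one_sub_smul_vecMulVec_mulVec, sub_eq_zero]
    constructor
    · rintro ⟨hF, hC⟩
      set t := (C ⬝ᵥ A *ᵥ B)⁻¹ * (C ⬝ᵥ A *ᵥ (A *ᵥ x + μ • M))
      have hx : x = A⁻¹ *ᵥ (t • B - μ • M) := by
        rw [← hF, add_sub_cancel_right, mulVec_mulVec, nonsing_inv_mul A hA, one_mulVec]
      have hts : t = s := by
        rw [hx, hCx] at hC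
        rw [hs]
        field_simp
        linarith
      rw [hx, hts, hx₀]
    · rintro rfl
      constructor
      · rw [hAx₀, mulVec_smul, dotProduct_smul, smul_eq_mul, mul_left_comm,
          inv_mul_cancel₀ hCAB, mul_one]
      · rw [hx₀, hCx, hs]
        field_simp
        ring
  · rw [hAx₀, mulVec_smul, dotProduct_smul, smul_eq_mul, hs]
    ring
end

section
/- Let n ≥ 2, let A ∈ ℝ^{n×n} be invertible, and let B, C ∈ ℝⁿ with CᵀAB ≠ 0 and CᵀB = 0. Define A_s = (I − B CᵀA/(CᵀAB)) A. Then X² divides the characteristic polynomial of A_s; equivalently, 0 is an eigenvalue of A_s of algebraic multiplicity at least two. (In particular, A_s(A⁻¹B) = 0 and (CᵀA)A_s = 0, i.e. A⁻¹B is a right null vector and AᵀC a left null vector of A_s, and these satisfy (CᵀA)(A⁻¹B) = CᵀB = 0.) -/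
open Matrix Polynomial

/-- A Jordan chain `u ↦ v ↦ 0` with `v ≠ 0` forces `X ^ 2` to divide the characteristic
polynomial. -/
theorem Matrix.X_sq_dvd_charpoly_of_jordan_chain {K ι : Type*} [Field K] [Fintype ι]
    [DecidableEq ι] (M : Matrix ι ι K) {u v : ι → K} (hv : v ≠ 0)
    (huv : M *ᵥ u = v) (hv0 : M *ᵥ v = 0) : X ^ 2 ∣ M.charpoly := by
  have hu : u ∈ Module.End.maxGenEigenspace (Matrix.toLin' M) 0 := by
    rw [Module.End.mem_maxGenEigenspace]
    exact ⟨2, by simp [pow_two, huv, hv0]⟩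
  have hv' : v ∈ Module.End.maxGenEigenspace (Matrix.toLin' M) 0 := by
    rw [Module.End.mem_maxGenEigenspace]
    exact ⟨1, by simp [hv0]⟩
  have hli : LinearIndependent K ![u, v] := by
    rw [LinearIndependent.pair_iff]
    intro s t hst
    have hs : s = 0 := by
      have h := congrArg (M *ᵥ ·) hst
      simpa [mulVec_add, mulVec_smul, huv, hv0, hv] using h
    subst hs
    simpa [hv] using hst
  have hspan : Submodule.span K (Set.range ![u, v]) ≤ Module.End.maxGenEigenspace (Matrix.toLin' M) 0 := by
    rw [Submodule.span_le]
    rintro _ ⟨i, rfl⟩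
    fin_cases i
    exacts [hu, hv']
  have hrank := Submodule.finrank_mono hspan
  rw [finrank_span_eq_card hli, Fintype.card_fin, LinearMap.finrank_maxGenEigenspace_eq,
    Matrix.charpoly_toLin', le_rootMultiplicity_iff M.charpoly_monic.ne_zero] at hrank
  simpa using hrank

/-- **Double zero eigenvalue of the sticking Jacobian (Section 2.1).**
Let `A_s = (I − B CᵀA/(CᵀAB)) A` be the Jacobian of the sticking vector field at the
boundary equilibrium, where `A` is invertible, `CᵀAB ≠ 0`, and `CᵀB = 0`. Then `X²`
divides the characteristic polynomial of `A_s`, i.e. `0` is an eigenvalue of algebraic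
multiplicity at least two; in particular `A⁻¹B` is a right null vector and `AᵀC` a left
null vector of `A_s`, and `(CᵀA)(A⁻¹B) = CᵀB = 0`. -/
theorem sticking_jacobian_double_zero_eigenvalue
    (n : ℕ) (hn : 2 ≤ n)
    (A : Matrix (Fin n) (Fin n) ℝ) (hA : IsUnit A.det)
    (B C : Fin n → ℝ)
    (hCAB : C ⬝ᵥ A.mulVec B ≠ 0)
    (hCB : C ⬝ᵥ B = 0)
    (As : Matrix (Fin n) (Fin n) ℝ)
    (hAs : As = ((1 : Matrix (Fin n) (Fin n) ℝ) -
      (C ⬝ᵥ A.mulVec B)⁻¹ • vecMulVec B (Matrix.vecMul C A)) * A) :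
    (X ^ 2 ∣ As.charpoly) ∧
    As.mulVec (A⁻¹.mulVec B) = 0 ∧
    Matrix.vecMul (Matrix.vecMul C A) As = 0 ∧
    Matrix.vecMul C A ⬝ᵥ A⁻¹.mulVec B = 0 := by
  have hAinv (x : Fin n → ℝ) : A *ᵥ (A⁻¹ *ᵥ x) = x := by
    rw [mulVec_mulVec, Matrix.mul_nonsing_inv A hA, one_mulVec]
  have hw (x : Fin n → ℝ) : Matrix.vecMul C A ⬝ᵥ x = C ⬝ᵥ A *ᵥ x := (dotProduct_mulVec C A x).symm
  have hAs_apply (x : Fin n → ℝ) : As *ᵥ x =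
      A *ᵥ x - ((C ⬝ᵥ A *ᵥ B)⁻¹ * (C ⬝ᵥ A *ᵥ (A *ᵥ x))) • B := by
    rw [hAs, ← mulVec_mulVec, sub_mulVec, one_mulVec, smul_mulVec, vecMulVec_mulVec, hw,
      op_smul_eq_smul, smul_smul]
  have hright : As *ᵥ (A⁻¹ *ᵥ B) = 0 := by
    rw [hAs_apply, hAinv, inv_mul_cancel₀ hCAB, one_smul, sub_self]
  have horth : Matrix.vecMul C A ⬝ᵥ A⁻¹ *ᵥ B = 0 := by rw [hw, hAinv, hCB]
  have hchain : As *ᵥ (A⁻¹ *ᵥ (A⁻¹ *ᵥ B)) = A⁻¹ *ᵥ B := by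
    rw [hAs_apply, hAinv, hAinv, hCB, mul_zero, zero_smul, sub_zero]
  have hne : A⁻¹ *ᵥ B ≠ 0 := by
    intro h
    have hB : B = 0 := by rw [← hAinv B, h, mulVec_zero]
    exact hCAB (by simp [hB])
  refine ⟨As.X_sq_dvd_charpoly_of_jordan_chain hne hchain hright, hright, ?_, horth⟩
  rw [hAs, ← vecMul_vecMul, vecMul_sub, vecMul_one, vecMul_smul, vecMul_vecMulVec, hw,
    smul_smul, inv_mul_cancel₀ hCAB, one_smul, sub_self, zero_vecMul]
end

section
/- Let n ≥ 2, let A ∈ ℝ^{n×n} be invertible, and let B, C ∈ ℝⁿ with CᵀAB ≠ 0 and CᵀB = 0. Define A_s = (I − B CᵀA/(CᵀAB)) A. Then the coefficient of X² in the characteristic polynomial det(X·I − A_s) equals (−1)^{n+1} (CᵀA⁻¹B / (CᵀAB)) det(A). Equivalently, writing det(X·I − A_s) = X² q(X) (which is possible since X² divides the characteristic polynomial), the product of the n − 2 remaining eigenvalues of A_s satisfies (−1)^{n−2} q(0)·(−1)^{n−2} = det(Â_s) = −(CᵀA⁻¹B / (CᵀAB)) det(A), where det(Â_s) denotes (−1)^{n−2}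 times the coefficient of X² in det(X·I − A_s). -/
open Matrix Polynomial

/-- The matrix determinant lemma in adjugate form. -/
theorem det_add_vecMulVec_of_det_ne_zero {R m : Type*} [CommRing R] [IsDomain R] [Fintype m]
    [DecidableEq m] (P : Matrix m m R) (hP : P.det ≠ 0) (u v : m → R) :
    (P + vecMulVec u v).det = P.det + v ⬝ᵥ P.adjugate *ᵥ u := by
  let f := algebraMap R (FractionRing R)
  have hf : Function.Injective f := IsFractionRing.injective R (FractionRing R)
  have hd : (f.mapMatrix P).det ≠ 0 := by
    rw [← RingHom.map_det]
    exact (map_ne_zero_iff f hf).2 hP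
  have hmap : f.mapMatrix (P + vecMulVec u v) =
      f.mapMatrix P + replicateCol Unit (f ∘ u) * replicateRow Unit (f ∘ v) := by
    rw [map_add, ← vecMulVec_eq]
    congr 1
    ext i j
    simp [vecMulVec_apply]
  have hentry : (replicateRow Unit (f ∘ v) * (f.mapMatrix P)⁻¹ * replicateCol Unit (f ∘ u))
      () () = (f ∘ v) ⬝ᵥ (f.mapMatrix P)⁻¹ *ᵥ (f ∘ u) := by
    rw [Matrix.mul_assoc]
    rfl
  apply hf
  rw [RingHom.map_det, hmap, det_add_replicateCol_mul_replicateRow (isUnit_iff_ne_zero.2 hd),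
    det_unique (1 + _), Matrix.add_apply, Matrix.one_apply_eq, hentry, inv_def, Ring.inverse_eq_inv', smul_mulVec, dotProduct_smul,
    smul_eq_mul, map_add, RingHom.map_det, RingHom.map_dotProduct, mul_add]
  have hadj : f ∘ (P.adjugate *ᵥ u) = (f.mapMatrix P).adjugate *ᵥ (f ∘ u) := by
    rw [← RingHom.map_adjugate]
    ext i
    exact RingHom.map_mulVec f _ _ i
  rw [hadj, mul_inv_cancel_left₀ hd]
  simp

/-- Multiplying the adjugate of the characteristic matrix by the square of the matrix. -/
theorem map_C_mul_map_C_mul_adjugate_charmatrix {R m : Type*} [CommRing R] [Fintype m]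
    [DecidableEq m] (A : Matrix m m R) :
    A.map C * (A.map C * A.charmatrix.adjugate) =
      (X ^ 2 : R[X]) • A.charmatrix.adjugate - (X * A.charpoly) • (1 : Matrix m m R[X]) -
        A.charpoly • A.map C := by
  have h : A.map C * A.charmatrix.adjugate =
      (X : R[X]) • A.charmatrix.adjugate - A.charpoly • (1 : Matrix m m R[X]) := by
    have hA : A.map C = (X : R[X]) • (1 : Matrix m m R[X]) - A.charmatrix := by
      rw [charmatrix, smul_one_eq_diagonal]
      simp [RingHom.mapMatrix_apply, scalar_apply]
    rw [hA, sub_mul, mul_adjugate, smul_mul_assoc, one_mul, charpoly]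
  rw [h, mul_sub, mul_smul_comm, mul_smul_comm, h, mul_one, smul_sub, smul_smul, smul_smul, sq]

/-- If `c ⬝ᵥ b = 0` and `k * (c ⬝ᵥ A *ᵥ b) = 1`, the characteristic polynomial of
`A - k • b cᵀ A²` is `X²` times a bilinear form in the adjugate of the characteristic matrix. -/
theorem charpoly_sub_smul_vecMulVec {R m : Type*} [CommRing R] [IsDomain R] [Fintype m]
    [DecidableEq m] (A : Matrix m m R) (b c : m → R) (k : R)
    (hk : k * (c ⬝ᵥ A *ᵥ b) = 1) (hcb : c ⬝ᵥ b = 0) :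
    (A - k • vecMulVec b (c ᵥ* A ᵥ* A)).charpoly =
      C k * (X ^ 2 * ((C ∘ c) ⬝ᵥ A.charmatrix.adjugate *ᵥ (C ∘ b))) := by
  have hv : (C ∘ (c ᵥ* A ᵥ* A) : m → R[X]) = (C ∘ c) ᵥ* A.map C ᵥ* A.map C := by
    have h : ∀ w : m → R, (C ∘ (w ᵥ* A) : m → R[X]) = (C ∘ w) ᵥ* A.map C := fun w => by
      ext1 i
      exact RingHom.map_vecMul C A w i
    rw [h, h]
  have hM : (A - k • vecMulVec b (c ᵥ* A ᵥ* A)).charmatrix =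
      A.charmatrix + vecMulVec (C ∘ b) (C k • ((C ∘ c) ᵥ* A.map C ᵥ* A.map C)) := by
    rw [← hv]
    ext1 i j
    simp only [charmatrix_apply, Matrix.sub_apply, Matrix.smul_apply, Matrix.add_apply, vecMulVec_apply, map_sub,
      map_mul, smul_eq_mul, Pi.smul_apply, Function.comp_apply]
    ring
  have hcb' : (C ∘ c : m → R[X]) ⬝ᵥ (C ∘ b) = 0 := by
    rw [← RingHom.map_dotProduct, hcb, map_zero]
  have hk' : C k * ((C ∘ c : m → R[X]) ⬝ᵥ A.map C *ᵥ (C ∘ b)) = 1 := by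
    have : (A.map C *ᵥ (C ∘ b) : m → R[X]) = C ∘ (A *ᵥ b) := by
      ext1 i
      exact (RingHom.map_mulVec C A b i).symm
    rw [this, ← RingHom.map_dotProduct, ← map_mul, hk, map_one]
  rw [charpoly, hM, det_add_vecMulVec_of_det_ne_zero _ A.charpoly_monic.ne_zero, smul_dotProduct,
    ← dotProduct_mulVec, ← dotProduct_mulVec, mulVec_mulVec, mulVec_mulVec, Matrix.mul_assoc,
    map_C_mul_map_C_mul_adjugate_charmatrix, sub_mulVec, sub_mulVec, dotProduct_sub,
    dotProduct_sub, smul_mulVec, smul_mulVec, smul_mulVec, dotProduct_smul, dotProduct_smul,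
    dotProduct_smul, one_mulVec, hcb', charpoly]
  simp only [smul_eq_mul]
  linear_combination (-A.charmatrix.det) * hk'

/-- The constant coefficient of a bilinear form in the adjugate of the characteristic matrix. -/
theorem coeff_zero_dotProduct_adjugate_charmatrix {R m : Type*} [CommRing R] [Fintype m]
    [DecidableEq m] (A : Matrix m m R) (b c : m → R) :
    ((C ∘ c : m → R[X]) ⬝ᵥ A.charmatrix.adjugate *ᵥ (C ∘ b)).coeff 0 =
      (-1) ^ (Fintype.card m - 1) * (c ⬝ᵥ A.adjugate *ᵥ b) := by
  have hev : (evalRingHom (0 : R)).mapMatrix A.charmatrix = (-1 : R) • A := by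
    ext i j
    by_cases h : i = j <;> simp [h]
  have hC : ∀ v : m → R, (evalRingHom (0 : R)) ∘ (C ∘ v) = v := fun v => by
    ext i
    simp
  have hadj : (evalRingHom (0 : R)) ∘ (A.charmatrix.adjugate *ᵥ (C ∘ b)) =
      ((-1 : R) • A).adjugate *ᵥ b := by
    rw [← hev, ← RingHom.map_adjugate]
    ext1 i
    rw [Function.comp_apply, RingHom.map_mulVec, hC]
    rfl
  rw [coeff_zero_eq_eval_zero, ← coe_evalRingHom, RingHom.map_dotProduct, hC, hadj,
    adjugate_smul, smul_mulVec, dotProduct_smul, smul_eq_mul]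

/-- **Determinant identity for the restricted sticking Jacobian (equation (2.10),
di Bernardo et al. Eq. 50).** With `A_s = (I − B CᵀA/(CᵀAB)) A` as in the sticking
vector field, `A` invertible, `CᵀAB ≠ 0`, `CᵀB = 0`, the coefficient of `X²` in the
characteristic polynomial of `A_s` equals `(−1)^{n+1}(CᵀA⁻¹B/(CᵀAB)) det A`;
equivalently `det(Â_s) := (−1)^{n−2}·(coefficient of X²)` satisfies
`det(Â_s) = −(CᵀA⁻¹B/(CᵀAB)) det A`. -/
theorem sticking_jacobian_determinant_identity
    (n : ℕ) (hn : 2 ≤ n)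
    (A : Matrix (Fin n) (Fin n) ℝ) (hA : IsUnit A.det)
    (B C : Fin n → ℝ)
    (hCAB : C ⬝ᵥ A.mulVec B ≠ 0)
    (hCB : C ⬝ᵥ B = 0)
    (As : Matrix (Fin n) (Fin n) ℝ)
    (hAs : As = ((1 : Matrix (Fin n) (Fin n) ℝ) -
      (C ⬝ᵥ A.mulVec B)⁻¹ • vecMulVec B (Matrix.vecMul C A)) * A) :
    As.charpoly.coeff 2 =
      (-1 : ℝ) ^ (n + 1) * ((C ⬝ᵥ A⁻¹.mulVec B) / (C ⬝ᵥ A.mulVec B)) * A.det ∧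
    (-1 : ℝ) ^ (n - 2) * As.charpoly.coeff 2 =
      -((C ⬝ᵥ A⁻¹.mulVec B) / (C ⬝ᵥ A.mulVec B)) * A.det := by
  have hAs' : As = A - (C ⬝ᵥ A *ᵥ B)⁻¹ • vecMulVec B (C ᵥ* A ᵥ* A) := by
    rw [hAs, sub_mul, one_mul, smul_mul_assoc, vecMulVec_mul]
  have hadj : A.adjugate = A.det • A⁻¹ := by
    rw [inv_def, smul_smul, Ring.mul_inverse_cancel _ hA, one_smul]
  have hcoeff : As.charpoly.coeff 2 =
      (-1 : ℝ) ^ (n - 1) * ((C ⬝ᵥ A⁻¹ *ᵥ B) / (C ⬝ᵥ A *ᵥ B)) * A.det := by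
    rw [hAs', charpoly_sub_smul_vecMulVec A B C _ (inv_mul_cancel₀ hCAB) hCB, coeff_C_mul,
      coeff_X_pow_mul', if_pos le_rfl, Nat.sub_self, coeff_zero_dotProduct_adjugate_charmatrix,
      hadj, smul_mulVec, dotProduct_smul, Fintype.card_fin, smul_eq_mul]
    ring
  obtain ⟨m, rfl⟩ := Nat.exists_eq_add_of_le' hn
  have hsq : ((-1 : ℝ) ^ m) * (-1) ^ m = 1 := by
    rw [← mul_pow]
    norm_num
  rw [hcoeff, show m + 2 - 1 = m + 1 by omega, show m + 2 - 2 = m by omega]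
  constructor
  · ring
  · linear_combination
      (-((C ⬝ᵥ A⁻¹ *ᵥ B) / (C ⬝ᵥ A *ᵥ B)) * A.det) * hsq
end

section
/- Let H : ℝⁿ → ℝ be C³, F : ℝⁿ → ℝⁿ be C², and W : ℝⁿ → ℝⁿ be C¹. Define v(x) = ∇H(x)ᵀF(x) and R(x) = x + W(x) v(x). If x₀ ∈ ℝⁿ satisfies v(x₀) = 0 (a grazing point) then the gradient of v ∘ R at x₀ equals (1 + ∇v(x₀)ᵀW(x₀)) ∇v(x₀). Consequently, if r : ℝⁿ → ℝ is any function continuous at x₀ satisfying v(R(x)) = −r(x) v(x) for all x in a neighbourhood of x₀, and ∇v(x₀) ≠ 0, then r(x₀) = −1 − ∇v(x₀)ᵀW(x₀); in particular the positivity r(x₀) > 0 of the coefficient of restitution is equivalent to ∇v(x₀)ᵀW(x₀) < −1. -/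
open Filter

/-- The product of a function that is differentiable at a zero with a merely continuous function
is differentiable there. -/
theorem HasFDerivAt.smul_of_eq_zero_of_continuousAt {E G : Type*}
    [NormedAddCommGroup E] [NormedSpace ℝ E] [NormedAddCommGroup G] [NormedSpace ℝ G]
    {c : E → ℝ} {c' : E →L[ℝ] ℝ} {f : E → G} {x : E}
    (hc : HasFDerivAt c c' x) (hx : c x = 0) (hf : ContinuousAt f x) :
    HasFDerivAt (fun y => c y • f y) (c'.smulRight (f x)) x := by
  have hO : c =O[nhds x] fun y => y - x := by
    simpa [hx] using hc.isBigO_sub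
  have ho : (fun y => f y - f x) =o[nhds x] fun _ => (1 : ℝ) :=
    (Asymptotics.isLittleO_one_iff ℝ).2 (tendsto_sub_nhds_zero_iff.2 hf)
  have h₁ : (fun y => c y • (f y - f x)) =o[nhds x] fun y => y - x := by
    have h := hO.norm_right.smul_isLittleO ho
    simp only [smul_eq_mul, mul_one] at h
    exact h.of_norm_right
  have h₂ := (hc.smul_const (f x)).isLittleO
  refine .of_isLittleO ((h₁.add h₂).congr_left fun y => ?_)
  simp only [hx, zero_smul, smul_sub, sub_zero]
  abel

/-- **Coefficient of restitution at a grazing point (equation (2.4)).**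
With velocity `v(x) = ∇H(x)ᵀF(x)` and reset law `R(x) = x + v(x)W(x)`, at a grazing
point `x₀` (where `v(x₀) = 0`) the gradient of `v ∘ R` equals
`(1 + ∇v(x₀)ᵀW(x₀))∇v(x₀)`; consequently any coefficient-of-restitution function `r`,
continuous at `x₀` and satisfying `v(R(x)) = −r(x)v(x)` near `x₀`, satisfies
`r(x₀) = −1 − ∇v(x₀)ᵀW(x₀)` (provided `∇v(x₀) ≠ 0`), and `r(x₀) > 0` iff
`∇v(x₀)ᵀW(x₀) < −1`. -/
theorem restitution_at_grazing
    (n : ℕ)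
    (H : (Fin n → ℝ) → ℝ) (hH : ContDiff ℝ 3 H)
    (F : (Fin n → ℝ) → (Fin n → ℝ)) (hF : ContDiff ℝ 2 F)
    (W : (Fin n → ℝ) → (Fin n → ℝ)) (hW : ContDiff ℝ 1 W)
    (v : (Fin n → ℝ) → ℝ) (hv : ∀ x, v x = fderiv ℝ H x (F x))
    (R : (Fin n → ℝ) → (Fin n → ℝ)) (hR : ∀ x, R x = x + v x • W x)
    (x₀ : Fin n → ℝ) (hx₀ : v x₀ = 0) :
    fderiv ℝ (fun x => v (R x)) x₀ = (1 + fderiv ℝ v x₀ (W x₀)) • fderiv ℝ v x₀ ∧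
    (∀ r : (Fin n → ℝ) → ℝ, ContinuousAt r x₀ →
      (∀ᶠ x in nhds x₀, v (R x) = -(r x) * v x) →
      fderiv ℝ v x₀ ≠ 0 →
      (r x₀ = -1 - fderiv ℝ v x₀ (W x₀) ∧
        (0 < r x₀ ↔ fderiv ℝ v x₀ (W x₀) < -1))) := by
  have hv_diff : HasFDerivAt v (fderiv ℝ v x₀) x₀ := by
    have hH' : Differentiable ℝ (fderiv ℝ H) :=
      (hH.fderiv_right (m := 2) (by norm_num)).differentiable (by norm_num)
    have hF' : Differentiable ℝ F := hF.differentiable (by norm_num)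
    rw [funext hv]
    exact ((hH' x₀).clm_apply (hF' x₀)).hasFDerivAt
  have hR_diff : HasFDerivAt R
      (ContinuousLinearMap.id ℝ _ + (fderiv ℝ v x₀).smulRight (W x₀)) x₀ := by
    rw [funext hR]
    exact (hasFDerivAt_id x₀).add
      (hv_diff.smul_of_eq_zero_of_continuousAt hx₀ hW.continuous.continuousAt)
  have hRx₀ : R x₀ = x₀ := by simp [hR, hx₀]
  have hvR : HasFDerivAt (fun x => v (R x))
      ((1 + fderiv ℝ v x₀ (W x₀)) • fderiv ℝ v x₀) x₀ := by
    have hv_diff' : HasFDerivAt v (fderiv ℝ v x₀) (R x₀) := by rwa [hRx₀]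
    refine (hv_diff'.comp x₀ hR_diff).congr_fderiv (ContinuousLinearMap.ext fun y => ?_)
    simp
    ring
  refine ⟨hvR.fderiv, fun r hr hrv hne => ?_⟩
  have hprod := (hv_diff.smul_of_eq_zero_of_continuousAt hx₀ hr.neg).congr_of_eventuallyEq
    (hrv.mono fun x hx => by simpa [mul_comm] using hx)
  obtain ⟨y, hy⟩ := DFunLike.ne_iff.1 hne
  have key := DFunLike.congr_fun (hvR.unique hprod) y
  simp only [smul_apply, ContinuousLinearMap.smulRight_apply, smul_eq_mul,
    Pi.neg_apply] at key
  have hr₀ : r x₀ = -1 - fderiv ℝ v x₀ (W x₀) := by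
    have := mul_right_cancel₀ hy (key.trans (mul_comm _ _))
    linarith
  refine ⟨hr₀, ?_⟩
  rw [hr₀]
  constructor <;> intro h <;> linarith
end

section
/- Let m ≥ 2 and let q : ℝ × ℝ × ℝ → ℝ, (z; μ, η) ↦ q(z; μ, η), be C^m with q(0; 0, 0) = 0 and (∂q/∂z)(0; 0, 0) = −1. Set a = (∂q/∂μ), b = (∂q/∂η), c = (1/2)(∂²q/∂z²), d = (∂²q/∂μ∂z), e = (∂²q/∂η∂z), all at (0; 0, 0), and assume bc + e ≠ 0. Let g₁(μ, η) be the local fixed-point branch and λ(μ, η) = (∂q/∂z)(g₁(μ, η); μ, η) its multiplier. Then there exist δ > 0 and a C^{m−1} function g₂ : (−δ, δ) → ℝ with g₂(0) = 0 and g₂′(0) = −(ac + d)/(bc + e) such that λ(μ, g₂(μ)) = −1 for all μ ∈ (−δ, δ); i.e. the multiplier equals −1 exactly on the curve η = g₂(μ) = −((ac + d)/(bc + e))μ + O(μ²). -/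
open Set

/-- The derivative of a map on `ℝ × ℝ × ℝ` composed with a curve. -/
lemma hasDerivAt_comp_curve {F : ℝ × ℝ × ℝ → ℝ} {x y z : ℝ → ℝ} {x' y' z' t : ℝ}
    (hF : DifferentiableAt ℝ F (x t, y t, z t))
    (hx : HasDerivAt x x' t) (hy : HasDerivAt y y' t) (hz : HasDerivAt z z' t) :
    HasDerivAt (fun s => F (x s, y s, z s))
      (x' * fderiv ℝ F (x t, y t, z t) (1, 0, 0) + y' * fderiv ℝ F (x t, y t, z t) (0, 1, 0)
        + z' * fderiv ℝ F (x t, y t, z t) (0, 0, 1)) t := by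
  have h := hF.hasFDerivAt.comp_hasDerivAt t (hx.prodMk (hy.prodMk hz))
  have hv : (x', y', z') = x' • ((1, 0, 0) : ℝ × ℝ × ℝ) + y' • ((0, 1, 0) : ℝ × ℝ × ℝ)
      + z' • ((0, 0, 1) : ℝ × ℝ × ℝ) := by simp
  rw [hv, map_add, map_add, map_smul, map_smul, map_smul] at h
  exact h

open Topology in
/-- The implicit function theorem for a scalar equation in the plane, with uniform local
uniqueness. -/
lemma exists_implicit_curve {L : ℝ × ℝ → ℝ} {n : ℕ} (hn : n ≠ 0)
    (hL : ContDiffAt ℝ (n : ℕ∞) L (0, 0)) {A B : ℝ}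
    (hA : HasDerivAt (fun μ => L (μ, 0)) A 0) (hB : HasDerivAt (fun η => L (0, η)) B 0)
    (hB0 : B ≠ 0) :
    ∃ δ > (0 : ℝ), ∃ g : ℝ → ℝ, ContDiffOn ℝ (n : ℕ∞) g (Ioo (-δ) δ) ∧ g 0 = 0 ∧
      deriv g 0 = -(A / B) ∧ ∃ ε > (0 : ℝ), ∀ μ ∈ Ioo (-δ) δ, L (μ, g μ) = L (0, 0) ∧
        ∀ η : ℝ, |η - g μ| < ε → L (μ, η) = L (0, 0) → η = g μ := by
  have hn' : ((n : ℕ∞) : WithTop ℕ∞) ≠ 0 := by exact_mod_cast hn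
  have hLd : DifferentiableAt ℝ L (0, 0) := hL.differentiableAt hn'
  have hA' : fderiv ℝ L (0, 0) (1, 0) = A :=
    (HasFDerivAt.comp_hasDerivAt (f := fun μ : ℝ => (μ, (0 : ℝ))) (0 : ℝ) hLd.hasFDerivAt
      ((hasDerivAt_id (0 : ℝ)).prodMk (hasDerivAt_const (0 : ℝ) (0 : ℝ)))).unique hA
  have hB' : fderiv ℝ L (0, 0) (0, 1) = B :=
    (hLd.hasFDerivAt.comp_hasDerivAt (0 : ℝ)
      ((hasDerivAt_const (0 : ℝ) (0 : ℝ)).prodMk (hasDerivAt_id (0 : ℝ)))).unique hB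
  have hinv : (fderiv ℝ L (0, 0) ∘L .inr ℝ ℝ ℝ).IsInvertible := by
    refine ⟨ContinuousLinearEquiv.unitsEquivAut ℝ (Units.mk0 B hB0), ?_⟩
    ext
    simp [hB']
  set g := hL.implicitFunction hn' hinv
  have hg0 : g 0 = 0 := hL.implicitFunction_apply_self hn' hinv
  have hgs : ContDiffAt ℝ (n : ℕ∞) g 0 := hL.contDiffAt_implicitFunction hn' hinv
  have hev : ∀ᶠ μ in 𝓝 (0 : ℝ), L (μ, g μ) = L (0, 0) :=
    hL.eventually_apply_implicitFunction hn' hinv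
  have huniq : ∀ᶠ v in 𝓝 ((0, 0) : ℝ × ℝ), L v = L (0, 0) ↔ g v.1 = v.2 :=
    hL.eventually_apply_eq_iff_implicitFunction hn' hinv
  have hgd : HasDerivAt g (deriv g 0) 0 := (hgs.differentiableAt hn').hasDerivAt
  have hder : A + deriv g 0 * B = 0 := by
    have hLd' : DifferentiableAt ℝ L (id (0 : ℝ), g 0) := by rw [hg0]; exact hLd
    have h := hLd'.hasFDerivAt.comp_hasDerivAt (0 : ℝ) ((hasDerivAt_id (0 : ℝ)).prodMk hgd)
    have h2 : HasDerivAt (fun μ => L (μ, g μ)) 0 0 :=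
      (hasDerivAt_const (0 : ℝ) (L (0, 0))).congr_of_eventuallyEq hev
    have h3 := h.unique h2
    have hv : ((1 : ℝ), deriv g 0) = ((1, 0) : ℝ × ℝ) + deriv g 0 • ((0, 1) : ℝ × ℝ) := by simp
    rw [hv, map_add, map_smul, hg0, id, hA', hB', smul_eq_mul] at h3
    exact h3
  obtain ⟨r, hr, hball⟩ := Metric.eventually_nhds_iff.1 huniq
  have hcont : ∀ᶠ μ in 𝓝 (0 : ℝ), |g μ| < r / 2 := by
    have := hgs.continuousAt.abs
    rw [ContinuousAt, hg0, abs_zero] at this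
    exact this.eventually_lt_const (half_pos hr)
  obtain ⟨s, hs, hsm⟩ := Metric.eventually_nhds_iff.1
    (((hgs.eventually (by simp)).and hev).and hcont)
  have key : ∀ μ ∈ Ioo (-min s r) (min s r), |μ| < s ∧ |μ| < r := fun μ hμ =>
    lt_min_iff.1 (abs_lt.2 hμ)
  have hmem : ∀ μ, |μ| < s → dist μ 0 < s := fun μ h => by simpa using h
  refine ⟨min s r, lt_min hs hr, g,
    fun μ hμ => (hsm (hmem μ (key μ hμ).1)).1.1.contDiffWithinAt, hg0, ?_, r / 2, half_pos hr,
    fun μ hμ => ⟨(hsm (hmem μ (key μ hμ).1)).1.2, fun η hη hLη => ?_⟩⟩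
  · field_simp
    linarith
  · have hgμ := (hsm (hmem μ (key μ hμ).1)).2
    have hη' : |η| < r := by
      have := abs_add_le (η - g μ) (g μ)
      rw [sub_add_cancel] at this
      linarith
    have hd : dist ((μ, η) : ℝ × ℝ) (0, 0) < r := by
      simp [Prod.dist_eq, (key μ hμ).2, hη']
    exact ((hball hd).1 hLη).symm

/-- **The period-doubling curve (equation (3.4)).**
With `q` as in the period-doubling centre-manifold reduction, `g₁` the local fixed-point
branch, `λ(μ,η) = ∂q/∂z(g₁(μ,η);μ,η)` the multiplier, and `bc + e ≠ 0`, there is a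
`C^{m-1}` curve `η = g₂(μ)` with `g₂(0) = 0` and `g₂'(0) = -(ac+d)/(bc+e)` on which the
multiplier equals `-1`, and locally exactly there. -/
theorem period_doubling_curve
    (m : ℕ) (hm : 2 ≤ m)
    (q : ℝ → ℝ → ℝ → ℝ)
    (hq : ContDiff ℝ (m : ℕ∞) (fun p : ℝ × ℝ × ℝ => q p.1 p.2.1 p.2.2))
    (h0 : q 0 0 0 = 0)
    (h1 : deriv (fun z => q z 0 0) 0 = -1)
    (a b c d e : ℝ)
    (ha : a = deriv (fun μ => q 0 μ 0) 0)
    (hb : b = deriv (fun η => q 0 0 η) 0)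
    (hc : c = (1/2) * iteratedDeriv 2 (fun z => q z 0 0) 0)
    (hd : d = deriv (fun μ => deriv (fun z => q z μ 0) 0) 0)
    (he : e = deriv (fun η => deriv (fun z => q z 0 η) 0) 0)
    (hbce : b * c + e ≠ 0)
    -- the unique local fixed-point branch
    (g₁ : ℝ → ℝ → ℝ)
    (hg₁smooth : ContDiffAt ℝ (m : ℕ∞) (fun p : ℝ × ℝ => g₁ p.1 p.2) (0, 0))
    (hg₁0 : g₁ 0 0 = 0)
    (hg₁fix : ∀ᶠ p : ℝ × ℝ in nhds (0, 0), q (g₁ p.1 p.2) p.1 p.2 = g₁ p.1 p.2)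
    -- the stability multiplier along the branch
    (lam : ℝ → ℝ → ℝ)
    (hlam : ∀ μ η, lam μ η = deriv (fun z => q z μ η) (g₁ μ η)) :
    ∃ δ > (0:ℝ), ∃ g₂ : ℝ → ℝ,
      ContDiffOn ℝ ((m - 1 : ℕ) : ℕ∞) g₂ (Ioo (-δ) δ) ∧
      g₂ 0 = 0 ∧
      deriv g₂ 0 = -((a * c + d) / (b * c + e)) ∧
      ∃ ε > (0:ℝ), ∀ μ ∈ Ioo (-δ) δ,
        lam μ (g₂ μ) = -1 ∧
        (∀ η : ℝ, |η - g₂ μ| < ε → lam μ η = -1 → η = g₂ μ) := by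
  set Q : ℝ × ℝ × ℝ → ℝ := fun p => q p.1 p.2.1 p.2.2
  set P : ℝ × ℝ × ℝ → ℝ := fun p => fderiv ℝ Q p (1, 0, 0)
  set L : ℝ × ℝ → ℝ := fun p => P (g₁ p.1 p.2, p.1, p.2)
  have hm0 : ((m : ℕ∞) : WithTop ℕ∞) ≠ 0 := by
    have : m ≠ 0 := by omega
    exact_mod_cast this
  have hn0 : m - 1 ≠ 0 := by omega
  have hn0' : (((m - 1 : ℕ) : ℕ∞) : WithTop ℕ∞) ≠ 0 := by exact_mod_cast hn0
  have hsucc : (((m - 1 : ℕ) : ℕ∞) : WithTop ℕ∞) + 1 ≤ ((m : ℕ∞) : WithTop ℕ∞) := by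
    have : m - 1 + 1 ≤ m := by omega
    exact_mod_cast this
  have hle : (((m - 1 : ℕ) : ℕ∞) : WithTop ℕ∞) ≤ ((m : ℕ∞) : WithTop ℕ∞) :=
    le_self_add.trans hsucc
  have hQd : Differentiable ℝ Q := hq.differentiable hm0
  have hPs : ContDiff ℝ ((m - 1 : ℕ) : ℕ∞) P :=
    (hq.fderiv_right hsucc).clm_apply contDiff_const
  have hPd : Differentiable ℝ P := hPs.differentiable hn0'
  have hqz (z μ η : ℝ) : deriv (fun z => q z μ η) z = P (z, μ, η) := by
    have h := hasDerivAt_comp_curve (hQd (z, μ, η)) (hasDerivAt_id z)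
      (hasDerivAt_const z μ) (hasDerivAt_const z η)
    simpa using h.deriv
  have hlamL (μ η : ℝ) : lam μ η = L (μ, η) := by rw [hlam, hqz]
  have ha' : a = fderiv ℝ Q (0, 0, 0) (0, 1, 0) := by
    have h := hasDerivAt_comp_curve (hQd (0, 0, 0)) (hasDerivAt_const (0 : ℝ) (0 : ℝ))
      (hasDerivAt_id (0 : ℝ)) (hasDerivAt_const (0 : ℝ) (0 : ℝ))
    rw [ha]
    simpa using h.deriv
  have hb' : b = fderiv ℝ Q (0, 0, 0) (0, 0, 1) := by
    have h := hasDerivAt_comp_curve (hQd (0, 0, 0)) (hasDerivAt_const (0 : ℝ) (0 : ℝ))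
      (hasDerivAt_const (0 : ℝ) (0 : ℝ)) (hasDerivAt_id (0 : ℝ))
    rw [hb]
    simpa using h.deriv
  have hc' : 2 * c = fderiv ℝ P (0, 0, 0) (1, 0, 0) := by
    have h := hasDerivAt_comp_curve (hPd (0, 0, 0)) (hasDerivAt_id (0 : ℝ))
      (hasDerivAt_const (0 : ℝ) (0 : ℝ)) (hasDerivAt_const (0 : ℝ) (0 : ℝ))
    have h2 : deriv (fun z => q z 0 0) = fun z => P (z, 0, 0) := funext fun z => hqz z 0 0
    rw [hc, iteratedDeriv_succ, iteratedDeriv_one, h2]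
    have h3 := h.deriv
    simp only [id] at h3
    rw [h3]
    ring
  have hd' : d = fderiv ℝ P (0, 0, 0) (0, 1, 0) := by
    have h := hasDerivAt_comp_curve (hPd (0, 0, 0)) (hasDerivAt_const (0 : ℝ) (0 : ℝ))
      (hasDerivAt_id (0 : ℝ)) (hasDerivAt_const (0 : ℝ) (0 : ℝ))
    simp only [hd, hqz]
    simpa using h.deriv
  have he' : e = fderiv ℝ P (0, 0, 0) (0, 0, 1) := by
    have h := hasDerivAt_comp_curve (hPd (0, 0, 0)) (hasDerivAt_const (0 : ℝ) (0 : ℝ))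
      (hasDerivAt_const (0 : ℝ) (0 : ℝ)) (hasDerivAt_id (0 : ℝ))
    simp only [he, hqz]
    simpa using h.deriv
  have hP0 : fderiv ℝ Q (0, 0, 0) (1, 0, 0) = -1 := by rw [← h1, hqz]
  have hL0 : L (0, 0) = -1 := by
    simp only [L, hg₁0]
    exact hP0
  have hLs : ContDiffAt ℝ ((m - 1 : ℕ) : ℕ∞) L (0, 0) :=
    hPs.contDiffAt.comp (0, 0) ((hg₁smooth.of_le hle).prodMk contDiffAt_id)
  have hg₁d : DifferentiableAt ℝ (fun p : ℝ × ℝ => g₁ p.1 p.2) (0, 0) :=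
    hg₁smooth.differentiableAt hm0
  have hA : HasDerivAt (fun μ => L (μ, 0)) (a * c + d) 0 := by
    have hline : HasDerivAt (fun μ : ℝ => (μ, (0 : ℝ))) (1, 0) 0 :=
      (hasDerivAt_id (0 : ℝ)).prodMk (hasDerivAt_const (0 : ℝ) (0 : ℝ))
    obtain ⟨k, hk⟩ : ∃ k, HasDerivAt (fun μ => g₁ μ 0) k 0 :=
      ⟨_, HasFDerivAt.comp_hasDerivAt (f := fun μ : ℝ => (μ, (0 : ℝ))) (0 : ℝ)
        hg₁d.hasFDerivAt hline⟩
    have h := hasDerivAt_comp_curve (hQd _) hk (hasDerivAt_id (0 : ℝ))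
      (hasDerivAt_const (0 : ℝ) (0 : ℝ))
    have hfix := h.congr_of_eventuallyEq
      ((hline.continuousAt.tendsto.eventually hg₁fix).mono fun μ hμ => hμ.symm)
    have hkk := hk.unique hfix
    simp only [id, hg₁0, hP0, ← ha'] at hkk
    have h2 := hasDerivAt_comp_curve (hPd _) hk (hasDerivAt_id (0 : ℝ))
      (hasDerivAt_const (0 : ℝ) (0 : ℝ))
    simp only [id, hg₁0, ← hc', ← hd'] at h2
    convert h2 using 1
    linear_combination (-c) * hkk
  have hB : HasDerivAt (fun η => L (0, η)) (b * c + e) 0 := by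
    have hline : HasDerivAt (fun η : ℝ => ((0 : ℝ), η)) (0, 1) 0 :=
      (hasDerivAt_const (0 : ℝ) (0 : ℝ)).prodMk (hasDerivAt_id (0 : ℝ))
    obtain ⟨k, hk⟩ : ∃ k, HasDerivAt (fun η => g₁ 0 η) k 0 :=
      ⟨_, hg₁d.hasFDerivAt.comp_hasDerivAt (0 : ℝ) hline⟩
    have h := hasDerivAt_comp_curve (hQd _) hk (hasDerivAt_const (0 : ℝ) (0 : ℝ))
      (hasDerivAt_id (0 : ℝ))
    have hfix := h.congr_of_eventuallyEq
      ((hline.continuousAt.tendsto.eventually hg₁fix).mono fun μ hμ => hμ.symm)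
    have hkk := hk.unique hfix
    simp only [id, hg₁0, hP0, ← hb'] at hkk
    have h2 := hasDerivAt_comp_curve (hPd _) hk (hasDerivAt_const (0 : ℝ) (0 : ℝ))
      (hasDerivAt_id (0 : ℝ))
    simp only [id, hg₁0, ← hc', ← he'] at h2
    convert h2 using 1
    linear_combination (-c) * hkk
  simpa only [hlamL, hL0] using exists_implicit_curve hn0 hLs hA hB hbce
end

section
/- Let q : ℝ × ℝ → ℝ, (z, β) ↦ q(z; β), be C⁴ such that q(0; β) = 0 and (∂q/∂z)(0; β) = −(1 + β) for all β near 0, (∂²q/∂z²)(0; 0) = 0, and (1/6)(∂³q/∂z³)(0; 0) = ĉ with ĉ > 0. Then there exist ε > 0 and functions z₊, z₋ : (0, ε) → ℝ with z₋(β) < 0 < z₊(β) such that for every β ∈ (0, ε): q(z₊(β); β) = z₋(β) and q(z₋(β); β) = z₊(β) (a period-two orbit of q(·; β)), and z_±(β) = ±√(β/ĉ) + o(√β) as β → 0⁺. -/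
open Set Asymptotics

/-- Partial derivative of a function on the plane in its first variable. -/
noncomputable def fstDeriv (f : ℝ × ℝ → ℝ) (p : ℝ × ℝ) : ℝ := fderiv ℝ f p (1, 0)

theorem ContDiff.fstDeriv {f : ℝ × ℝ → ℝ} {m n : WithTop ℕ∞} (hf : ContDiff ℝ n f)
    (hmn : m + 1 ≤ n) : ContDiff ℝ m (fstDeriv f) :=
  (hf.fderiv_right hmn).clm_apply contDiff_const

theorem hasDerivAt_fstDeriv {f : ℝ × ℝ → ℝ} (hf : Differentiable ℝ f) (z β : ℝ) :
    HasDerivAt (fun z => f (z, β)) (fstDeriv f (z, β)) z :=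
  (hf (z, β)).hasFDerivAt.comp_hasDerivAt z ((hasDerivAt_id z).prodMk (hasDerivAt_const z β))

theorem abs_le_mul_abs_of_abs_deriv_le {f f' : ℝ → ℝ} {r B : ℝ} (hf : ∀ x, HasDerivAt f (f' x) x)
    (h0 : f 0 = 0) (hB : ∀ x, |x| ≤ r → |f' x| ≤ B) {z : ℝ} (hz : |z| ≤ r) :
    |f z| ≤ B * |z| := by
  have h := (convex_Icc (-r) r).norm_image_sub_le_of_norm_hasDerivWithin_le (f := f) (f' := f')
    (x := 0) (y := z) (fun x _ => (hf x).hasDerivWithinAt)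
    (fun x hx => hB x (abs_le.2 hx)) (abs_le.1 (by simpa using (abs_nonneg z).trans hz))
    (abs_le.1 hz)
  simpa [h0] using h

open Filter Topology in
/-- Cubic Taylor estimate at the origin for a family in period-doubling normal form. -/
theorem exists_abs_sub_cubic_le {F : ℝ × ℝ → ℝ} {c : ℝ} (hF : ContDiff ℝ 4 F)
    (h0 : ∀ᶠ β in 𝓝 (0 : ℝ), F (0, β) = 0 ∧ fstDeriv F (0, β) = -(1 + β))
    (h2 : fstDeriv (fstDeriv F) (0, 0) = 0)
    (h3 : fstDeriv (fstDeriv (fstDeriv F)) (0, 0) = 6 * c) :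
    ∃ K, ∀ η > 0, ∃ r > 0, ∀ z β, |z| ≤ r → |β| ≤ r →
      |F (z, β) + (1 + β) * z - c * z ^ 3| ≤ (K * |β| + η * |z|) * |z| * |z| := by
  have c1 : ContDiff ℝ 3 (fstDeriv F) := hF.fstDeriv (by norm_num)
  have c2 : ContDiff ℝ 2 (fstDeriv (fstDeriv F)) := c1.fstDeriv (by norm_num)
  have c3 : ContDiff ℝ 1 (fstDeriv (fstDeriv (fstDeriv F))) := c2.fstDeriv (by norm_num)
  have d0 := hasDerivAt_fstDeriv (hF.differentiable (by norm_num))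
  have d1 := hasDerivAt_fstDeriv (c1.differentiable (by norm_num))
  have d2 := hasDerivAt_fstDeriv (c2.differentiable (by norm_num))
  have hO : DifferentiableAt ℝ (fun β : ℝ => fstDeriv (fstDeriv F) (0, β)) 0 :=
    ((c2.differentiable (by norm_num)).comp
      (differentiable_const (0 : ℝ) |>.prodMk differentiable_id)) 0
  obtain ⟨K, hK⟩ := hO.isBigO_sub.bound
  refine ⟨K, fun η hη => ?_⟩
  have hc : ∀ᶠ p in 𝓝 ((0 : ℝ), (0 : ℝ)),
      |fstDeriv (fstDeriv (fstDeriv F)) p - 6 * c| < η := by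
    have := (c3.continuous.tendsto (0, 0)).sub_const (6 * c) |>.abs
    rw [h3, sub_self, abs_zero] at this
    exact this.eventually_lt_const hη
  obtain ⟨r₁, hr₁, H₁⟩ := Metric.eventually_nhds_iff.1 hc
  obtain ⟨r₂, hr₂, H₂⟩ := Metric.eventually_nhds_iff.1 (h0.and hK)
  refine ⟨min r₁ r₂ / 2, by positivity, fun z β hz hβ => ?_⟩
  have hm := lt_min hr₁ hr₂
  have hm₁ := min_le_left r₁ r₂
  have hm₂ := min_le_right r₁ r₂
  obtain ⟨⟨hβ0, hβ1⟩, hβ2⟩ := H₂ (y := β) (by rw [Real.dist_eq, sub_zero]; linarith)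
  simp only [h2, sub_zero, Real.norm_eq_abs] at hβ2
  have b2 : ∀ x, |x| ≤ |z| → |fstDeriv (fstDeriv F) (x, β) - 6 * c * x| ≤ K * |β| + η * |z| := by
    intro x hx
    have := abs_le_mul_abs_of_abs_deriv_le (r := |z|) (B := η) (z := x)
      (f := fun x => fstDeriv (fstDeriv F) (x, β) - 6 * c * x - fstDeriv (fstDeriv F) (0, β))
      (f' := fun x => fstDeriv (fstDeriv (fstDeriv F)) (x, β) - 6 * c)
      (fun x => by
        refine (((d2 x β).sub ((hasDerivAt_id x).const_mul (6 * c))).sub_const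
          (fstDeriv (fstDeriv F) (0, β))).congr_deriv ?_
        rw [mul_one])
      (by simp)
      (fun y hy => (H₁ (by
        rw [Prod.dist_eq, max_lt_iff]
        simp only [Real.dist_eq, sub_zero]
        constructor <;> linarith)).le) hx
    have e : fstDeriv (fstDeriv F) (x, β) - 6 * c * x =
      fstDeriv (fstDeriv F) (x, β) - 6 * c * x - fstDeriv (fstDeriv F) (0, β)
        + fstDeriv (fstDeriv F) (0, β) := by ring
    rw [e]
    refine (abs_add_le _ _).trans ?_
    nlinarith [mul_le_mul_of_nonneg_left hx hη.le]
  have hB : 0 ≤ K * |β| + η * |z| := (abs_nonneg _).trans (b2 0 (by simp))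
  have b1 : ∀ x, |x| ≤ |z| → |fstDeriv F (x, β) + (1 + β) - 3 * c * x ^ 2| ≤
      (K * |β| + η * |z|) * |z| := by
    intro x hx
    refine (abs_le_mul_abs_of_abs_deriv_le
      (f := fun x => fstDeriv F (x, β) + (1 + β) - 3 * c * x ^ 2)
      (f' := fun x => fstDeriv (fstDeriv F) (x, β) - 6 * c * x) (fun x => ?_)
      (by simp [hβ1]) b2 hx).trans (mul_le_mul_of_nonneg_left hx hB)
    refine (((d1 x β).add_const (1 + β)).sub
      ((hasDerivAt_pow 2 x).const_mul (3 * c))).congr_deriv ?_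
    norm_num
    ring
  refine abs_le_mul_abs_of_abs_deriv_le
    (f := fun x => F (x, β) + (1 + β) * x - c * x ^ 3)
    (f' := fun x => fstDeriv F (x, β) + (1 + β) - 3 * c * x ^ 2) (fun x => ?_)
    (by simp [hβ0]) b1 le_rfl
  refine (((d0 x β).add ((hasDerivAt_id x).const_mul (1 + β))).sub
    ((hasDerivAt_pow 3 x).const_mul c)).congr_deriv ?_
  norm_num
  ring

open Filter Topology in
/-- The map in the scaling `z = s * x`, `β = s ^ 2` is `x ↦ -x + s ^ 2 * (c * x ^ 3 - x)` up to
higher order in `s`, along convergent families of points. -/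
theorem tendsto_rescaled {q : ℝ → ℝ → ℝ} {c : ℝ}
    (hq : ∃ K, ∀ η > 0, ∃ r > 0, ∀ z β, |z| ≤ r → |β| ≤ r →
      |q z β + (1 + β) * z - c * z ^ 3| ≤ (K * |β| + η * |z|) * |z| * |z|)
    {x : ℝ → ℝ} {a : ℝ} (hx : Tendsto x (𝓝[>] 0) (𝓝 a)) :
    Tendsto (fun s => (q (s * x s) (s ^ 2) / s + x s) / s ^ 2) (𝓝[>] 0) (𝓝 (c * a ^ 3 - a)) := by
  obtain ⟨K, hK⟩ := hq
  have hs : Tendsto (fun s : ℝ => s) (𝓝[>] 0) (𝓝 0) := tendsto_nhdsWithin_of_tendsto_nhds tendsto_id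
  have key : Tendsto (fun s => (q (s * x s) (s ^ 2) / s + x s) / s ^ 2 - (c * x s ^ 3 - x s))
      (𝓝[>] 0) (𝓝 0) := by
    rw [Metric.tendsto_nhds]
    intro ε hε
    have hM : 0 < |a| ^ 3 + 1 := by positivity
    obtain ⟨r, hr, H⟩ := hK (ε / (|a| ^ 3 + 1)) (by positivity)
    have l1 : Tendsto (fun s => |s * x s|) (𝓝[>] 0) (𝓝 0) := by simpa using (hs.mul hx).abs
    have l2 : Tendsto (fun s : ℝ => |s ^ 2|) (𝓝[>] 0) (𝓝 0) := by simpa using (hs.pow 2).abs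
    have l3 : Tendsto (fun s => K * s * |x s| ^ 2 + ε / (|a| ^ 3 + 1) * |x s| ^ 3) (𝓝[>] 0)
        (𝓝 (K * 0 * |a| ^ 2 + ε / (|a| ^ 3 + 1) * |a| ^ 3)) :=
      ((hs.const_mul K).mul (hx.abs.pow 2)).add ((hx.abs.pow 3).const_mul _)
    have hlt : K * 0 * |a| ^ 2 + ε / (|a| ^ 3 + 1) * |a| ^ 3 < ε := by
      rw [mul_zero, zero_mul, zero_add, div_mul_eq_mul_div, div_lt_iff₀ hM]
      linarith
    filter_upwards [l1.eventually_le_const hr, l2.eventually_le_const hr,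
      l3.eventually_lt_const hlt, self_mem_nhdsWithin] with s h1 h2 h3 (h4 : 0 < s)
    have h := H _ _ h1 h2
    rw [Real.dist_eq, sub_zero]
    have e : (q (s * x s) (s ^ 2) / s + x s) / s ^ 2 - (c * x s ^ 3 - x s) =
        (q (s * x s) (s ^ 2) + (1 + s ^ 2) * (s * x s) - c * (s * x s) ^ 3) / s ^ 3 := by
      field_simp
      ring
    rw [e, abs_div, abs_of_pos (pow_pos h4 3), div_lt_iff₀ (pow_pos h4 3)]
    refine h.trans_lt ?_
    rw [abs_mul, abs_of_pos h4, abs_of_pos (pow_pos h4 2)]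
    calc _ = (K * s * |x s| ^ 2 + ε / (|a| ^ 3 + 1) * |x s| ^ 3) * s ^ 3 := by ring
      _ < _ := mul_lt_mul_of_pos_right h3 (pow_pos h4 3)
  have := key.add (((hx.pow 3).const_mul c).sub hx)
  simpa using this

open Filter Topology in
theorem tendsto_rescaled_neg {q : ℝ → ℝ → ℝ} {c : ℝ}
    (hq : ∃ K, ∀ η > 0, ∃ r > 0, ∀ z β, |z| ≤ r → |β| ≤ r →
      |q z β + (1 + β) * z - c * z ^ 3| ≤ (K * |β| + η * |z|) * |z| * |z|)
    {x : ℝ → ℝ} {a : ℝ} (hx : Tendsto x (𝓝[>] 0) (𝓝 a)) :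
    Tendsto (fun s => q (s * x s) (s ^ 2) / s) (𝓝[>] 0) (𝓝 (-a)) := by
  have hs : Tendsto (fun s : ℝ => s) (𝓝[>] 0) (𝓝 0) := tendsto_nhdsWithin_of_tendsto_nhds tendsto_id
  have h := ((tendsto_rescaled hq hx).mul (hs.pow 2)).sub hx
  have e : (c * a ^ 3 - a) * 0 ^ 2 - a = -a := by ring
  rw [e] at h
  refine h.congr' ?_
  filter_upwards [self_mem_nhdsWithin] with s (h4 : 0 < s)
  field_simp
  ring

open Filter Topology in
theorem tendsto_rescaled_second_iterate {q : ℝ → ℝ → ℝ} {c : ℝ}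
    (hq : ∃ K, ∀ η > 0, ∃ r > 0, ∀ z β, |z| ≤ r → |β| ≤ r →
      |q z β + (1 + β) * z - c * z ^ 3| ≤ (K * |β| + η * |z|) * |z| * |z|) (a : ℝ) :
    Tendsto (fun s => (q (q (s * a) (s ^ 2)) (s ^ 2) - s * a) / s ^ 3) (𝓝[>] 0)
      (𝓝 (2 * (a - c * a ^ 3))) := by
  have hx : Tendsto (fun _ : ℝ => a) (𝓝[>] 0) (𝓝 a) := tendsto_const_nhds
  have h := (tendsto_rescaled hq (tendsto_rescaled_neg hq hx)).sub (tendsto_rescaled hq hx)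
  have e : c * (-a) ^ 3 - -a - (c * a ^ 3 - a) = 2 * (a - c * a ^ 3) := by ring
  rw [e] at h
  refine h.congr' ?_
  filter_upwards [self_mem_nhdsWithin] with s (h4 : 0 < s)
  rw [mul_div_cancel₀ _ h4.ne']
  field_simp
  ring

open Filter Topology in
/-- Points of closed sets accumulating at `a` along a filter can be selected to converge to `a`. -/
theorem exists_tendsto_of_forall_eventually_exists_dist_lt {ι : Type*} {l : Filter ι}
    {S : ι → Set ℝ} {a : ℝ} (hS : ∀ i, IsClosed (S i))
    (h : ∀ δ > 0, ∀ᶠ i in l, ∃ x ∈ S i, dist a x < δ) :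
    ∃ x : ι → ℝ, Tendsto x l (𝓝 a) ∧ ∀ᶠ i in l, x i ∈ S i := by
  have hsel : ∀ i, ∃ x, (S i).Nonempty → x ∈ S i ∧ Metric.infDist a (S i) = dist a x := by
    intro i
    by_cases hne : (S i).Nonempty
    · obtain ⟨x, hx⟩ := (hS i).exists_infDist_eq_dist hne a
      exact ⟨x, fun _ => hx⟩
    · exact ⟨a, fun h => absurd h hne⟩
  choose x hx using hsel
  refine ⟨x, Metric.tendsto_nhds.2 fun δ hδ => ?_, ?_⟩
  · filter_upwards [h δ hδ] with i hi
    obtain ⟨y, hy, hlt⟩ := hi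
    rw [dist_comm, ← (hx i ⟨y, hy⟩).2]
    exact (Metric.infDist_le_dist_of_mem hy).trans_lt hlt
  · filter_upwards [h 1 one_pos] with i hi
    obtain ⟨y, hy, -⟩ := hi
    exact (hx i ⟨y, hy⟩).1

open Filter Topology in
theorem exists_rescaled_fixed_point_second_iterate {q : ℝ → ℝ → ℝ} {c : ℝ}
    (hcont : Continuous (fun p : ℝ × ℝ => q p.1 p.2))
    (hq : ∃ K, ∀ η > 0, ∃ r > 0, ∀ z β, |z| ≤ r → |β| ≤ r →
      |q z β + (1 + β) * z - c * z ^ 3| ≤ (K * |β| + η * |z|) * |z| * |z|)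
    {a : ℝ} (ha : 0 < a) (hca : c * a ^ 2 = 1) :
    ∃ x : ℝ → ℝ, Tendsto x (𝓝[>] 0) (𝓝 a) ∧
      ∀ᶠ s in 𝓝[>] 0, q (q (s * x s) (s ^ 2)) (s ^ 2) = s * x s := by
  have hc : 0 < c := pos_of_mul_pos_left (hca ▸ one_pos) (sq_nonneg a)
  have hcs : ∀ s, Continuous fun x => q (q (s * x) (s ^ 2)) (s ^ 2) - s * x := by
    intro s
    have h1 : Continuous fun x => q (s * x) (s ^ 2) :=
      hcont.comp ((continuous_const.mul continuous_id).prodMk continuous_const)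
    exact (hcont.comp (h1.prodMk continuous_const)).sub (continuous_const.mul continuous_id)
  have key := exists_tendsto_of_forall_eventually_exists_dist_lt (l := 𝓝[>] (0 : ℝ)) (a := a)
    (S := fun s => {x | q (q (s * x) (s ^ 2)) (s ^ 2) - s * x = 0})
    (fun s => isClosed_eq (hcs s) continuous_const) ?_
  · obtain ⟨x, hx, hS⟩ := key
    exact ⟨x, hx, hS.mono fun s hs => sub_eq_zero.1 hs⟩
  intro δ hδ
  obtain ⟨d, hd, hda, hdδ⟩ : ∃ d, 0 < d ∧ d < a ∧ d < δ :=
    ⟨min a δ / 2, by positivity, by linarith [min_le_left a δ, lt_min ha hδ],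
      by linarith [min_le_right a δ, lt_min ha hδ]⟩
  have hfac : ∀ u, 2 * (u - c * u ^ 3) = 2 * c * u * (a - u) * (a + u) := fun u => by
    linear_combination (-2 * u) * hca
  have hpos : 0 < 2 * ((a - d) - c * (a - d) ^ 3) := by
    rw [hfac]
    have h1 : 0 < a - d := by linarith
    have h2 : 0 < a - (a - d) := by linarith
    positivity
  have hneg : 2 * ((a + d) - c * (a + d) ^ 3) < 0 := by
    rw [hfac]
    have : 0 < 2 * c * (a + d) * d * (a + (a + d)) := by positivity
    linarith
  filter_upwards [(tendsto_rescaled_second_iterate hq (a - d)).eventually_const_lt hpos,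
    (tendsto_rescaled_second_iterate hq (a + d)).eventually_lt_const hneg,
    self_mem_nhdsWithin] with s h1 h2 (h4 : 0 < s)
  have h3 := pow_pos h4 3
  rw [div_pos_iff_of_pos_right h3] at h1
  rw [div_lt_iff₀ h3, zero_mul] at h2
  obtain ⟨x, hx, hx0⟩ := intermediate_value_Icc' (by linarith : a - d ≤ a + d)
    (hcs s).continuousOn ⟨h2.le, h1.le⟩
  refine ⟨x, hx0, ?_⟩
  rw [Real.dist_eq, abs_lt]
  constructor <;> linarith [hx.1, hx.2]

open Set Asymptotics

/-- **Existence and amplitude of the period-doubled orbit (used in Theorem 3.2 and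
Appendix B.2).** For a `C⁴` one-parameter family `q(·;β)` in period-doubling normal
form — `q(0;β) = 0` and `∂q/∂z(0;β) = -(1+β)` for all `β` near `0`, vanishing quadratic
coefficient and cubic coefficient `ĉ > 0` at `β = 0` — there is, for small `β > 0`, a
period-two orbit `{z₋(β), z₊(β)}` with `z₋(β) < 0 < z₊(β)` and
`z_±(β) = ±√(β/ĉ) + o(√β)` as `β → 0⁺`. -/
theorem period_two_orbit_amplitude
    (q : ℝ → ℝ → ℝ)
    (hq : ContDiff ℝ 4 (fun p : ℝ × ℝ => q p.1 p.2))
    (h0 : ∀ᶠ β in nhds (0 : ℝ), q 0 β = 0 ∧ deriv (fun z => q z β) 0 = -(1 + β))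
    (h2 : iteratedDeriv 2 (fun z => q z 0) 0 = 0)
    (chat : ℝ) (hchat : chat = iteratedDeriv 3 (fun z => q z 0) 0 / 6)
    (hchatpos : 0 < chat) :
    ∃ ε > (0:ℝ), ∃ zp zm : ℝ → ℝ,
      (∀ β ∈ Ioo (0:ℝ) ε, zm β < 0 ∧ 0 < zp β ∧
        q (zp β) β = zm β ∧ q (zm β) β = zp β) ∧
      (fun β => zp β - Real.sqrt (β / chat)) =o[nhdsWithin 0 (Ioi 0)]
        (fun β => Real.sqrt β) ∧
      (fun β => zm β + Real.sqrt (β / chat)) =o[nhdsWithin 0 (Ioi 0)]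
        (fun β => Real.sqrt β) := by
  have hF0 : ∀ z β, HasDerivAt (fun z => q z β) (fstDeriv (fun p => q p.1 p.2) (z, β)) z :=
    hasDerivAt_fstDeriv (f := fun p => q p.1 p.2) (hq.differentiable (by norm_num))
  have c1 : ContDiff ℝ 3 (fstDeriv (fun p => q p.1 p.2)) := hq.fstDeriv (by norm_num)
  have c2 : ContDiff ℝ 2 (fstDeriv (fstDeriv (fun p => q p.1 p.2))) := c1.fstDeriv (by norm_num)
  have e1 : deriv (fun z => q z 0) = fun z => fstDeriv (fun p => q p.1 p.2) (z, 0) :=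
    funext fun z => (hF0 z 0).deriv
  have e2 : iteratedDeriv 2 (fun z => q z 0) =
      fun z => fstDeriv (fstDeriv (fun p => q p.1 p.2)) (z, 0) := by
    rw [iteratedDeriv_succ, iteratedDeriv_one, e1]
    exact funext fun z => (hasDerivAt_fstDeriv (c1.differentiable (by norm_num)) z 0).deriv
  have e3 : iteratedDeriv 3 (fun z => q z 0) =
      fun z => fstDeriv (fstDeriv (fstDeriv (fun p => q p.1 p.2))) (z, 0) := by
    rw [iteratedDeriv_succ, e2]
    exact funext fun z => (hasDerivAt_fstDeriv (c2.differentiable (by norm_num)) z 0).deriv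
  have hR := exists_abs_sub_cubic_le (c := chat) hq
    (h0.mono fun β hβ => ⟨hβ.1, (hF0 0 β).deriv ▸ hβ.2⟩) (by simpa [e2] using h2)
    (by rw [hchat, e3]; ring)
  have ha : 0 < √(1 / chat) := by positivity
  have hca : chat * √(1 / chat) ^ 2 = 1 := by
    rw [Real.sq_sqrt (by positivity)]
    field_simp
  obtain ⟨x, hx, hfix⟩ := exists_rescaled_fixed_point_second_iterate hq.continuous hR ha hca
  have hy := tendsto_rescaled_neg hR hx
  have hsqrt : Filter.Tendsto Real.sqrt (nhdsWithin 0 (Ioi 0)) (nhdsWithin 0 (Ioi 0)) := by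
    refine tendsto_nhdsWithin_iff.2 ⟨?_, ?_⟩
    · simpa using (Real.continuous_sqrt.tendsto 0).mono_left nhdsWithin_le_nhds
    · filter_upwards [self_mem_nhdsWithin] with β hβ using Real.sqrt_pos.2 hβ
  have hev := hsqrt.eventually (hfix.and ((hx.eventually_const_lt ha).and
    (hy.eventually_lt_const (neg_lt_zero.2 ha))))
  obtain ⟨ε, hε, H⟩ := mem_nhdsGT_iff_exists_Ioo_subset.1 hev
  have hdiv : ∀ β, √(β / chat) = √β * √(1 / chat) := fun β => by
    rw [← Real.sqrt_mul' _ (by positivity), mul_one_div]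
  refine ⟨ε, hε, fun β => √β * x √β, fun β => q (√β * x √β) β, fun β hβ => ?_, ?_, ?_⟩
  · obtain ⟨h1, h2, h3⟩ := H hβ
    have hs := Real.sqrt_pos.2 hβ.1
    rw [Real.sq_sqrt hβ.1.le] at h1 h3
    exact ⟨by simpa [div_lt_iff₀ hs] using h3, mul_pos hs h2, rfl, h1⟩
  · refine isLittleO_iff_exists_eq_mul.2 ⟨fun β => x √β - √(1 / chat), ?_, ?_⟩
    · simpa using (hx.comp hsqrt).sub_const √(1 / chat)
    · refine Filter.Eventually.of_forall fun β => ?_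
      simp only [Pi.mul_apply]
      rw [hdiv β]
      ring
  · refine isLittleO_iff_exists_eq_mul.2
      ⟨fun β => q (√β * x √β) (√β ^ 2) / √β + √(1 / chat), ?_, ?_⟩
    · simpa using (hy.comp hsqrt).add_const √(1 / chat)
    · filter_upwards [self_mem_nhdsWithin] with β (hβ : 0 < β)
      simp only [Pi.mul_apply, Real.sq_sqrt hβ.le]
      rw [hdiv β, add_mul, div_mul_cancel₀ _ (Real.sqrt_pos.2 hβ).ne']
      ring
end
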